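/- Every complete CAT(0) space has non-positive curvature in the sense of intersection of balls: if X is a complete CAT(0) space, x₁,x₂,x₃ ∈ X have positive Gromov products r₁,r₂,r₃, and x̄₁,x̄₂,x̄₃ is a comparison triangle in the Euclidean plane ℝ² (‖x̄ᵢ−x̄ⱼ‖ = d(xᵢ,xⱼ) for all i < j), then ρ(x₁,x₂,x₃) ≤ ρ(x̄₁,x̄₂,x̄₃), where ρ(x₁,x₂,x₃) := inf over x ∈ X of max{d(x₁,x)/r₁, d(x₂,x)/r₂, d(x₃,x)/r₃} and ρ(x̄₁,x̄₂,x̄₃) := inf over x ∈ ℝ² of max{‖x−x̄₁‖/r₁, ‖x−x̄₂‖/r₂, ‖x−x̄₃‖/r₃}. -/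

import Mathlib

/-- `γ` is a geodesic from `x` to `y`: an isometric embedding of `[0, dist x y]`
with `γ 0 = x` and `γ (dist x y) = y`. -/
def IsGeodesicFrom {X : Type*} [MetricSpace X] (x y : X) (γ : ℝ → X) : Prop :=
  γ 0 = x ∧ γ (dist x y) = y ∧
    ∀ s ∈ Set.Icc (0:ℝ) (dist x y), ∀ t ∈ Set.Icc (0:ℝ) (dist x y),
      dist (γ s) (γ t) = |s - t|

/-- A metric space is geodesic if every pair of points is joined by a geodesic. -/
def GeodesicSpace (X : Type*) [MetricSpace X] : Prop :=
  ∀ x y : X, ∃ γ : ℝ → X, IsGeodesicFrom x y γ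

/-- The point at arclength `t` on the Euclidean segment from `a` to `b`. -/
noncomputable def cmpPt (a b : EuclideanSpace ℝ (Fin 2)) (t : ℝ) :
    EuclideanSpace ℝ (Fin 2) :=
  AffineMap.lineMap a b (t / dist a b)

/-- A geodesic metric space is CAT(0) if every geodesic triangle satisfies the
comparison inequality with respect to any comparison triangle in the Euclidean
plane: any two points on the sides of the triangle are at distance at most the
distance of the corresponding points (at the same arclength parameters) on the
comparison triangle. -/
def IsCAT0 (X : Type*) [MetricSpace X] : Prop :=
  GeodesicSpace X ∧
  ∀ (x₁ x₂ x₃ : X) (γ₁₂ γ₁₃ γ₂₃ : ℝ → X),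
    IsGeodesicFrom x₁ x₂ γ₁₂ → IsGeodesicFrom x₁ x₃ γ₁₃ → IsGeodesicFrom x₂ x₃ γ₂₃ →
    ∀ (y₁ y₂ y₃ : EuclideanSpace ℝ (Fin 2)),
      dist y₁ y₂ = dist x₁ x₂ → dist y₁ y₃ = dist x₁ x₃ → dist y₂ y₃ = dist x₂ x₃ →
      (∀ s ∈ Set.Icc (0:ℝ) (dist x₁ x₂), ∀ t ∈ Set.Icc (0:ℝ) (dist x₁ x₂),
        dist (γ₁₂ s) (γ₁₂ t) ≤ dist (cmpPt y₁ y₂ s) (cmpPt y₁ y₂ t)) ∧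
      (∀ s ∈ Set.Icc (0:ℝ) (dist x₁ x₃), ∀ t ∈ Set.Icc (0:ℝ) (dist x₁ x₃),
        dist (γ₁₃ s) (γ₁₃ t) ≤ dist (cmpPt y₁ y₃ s) (cmpPt y₁ y₃ t)) ∧
      (∀ s ∈ Set.Icc (0:ℝ) (dist x₂ x₃), ∀ t ∈ Set.Icc (0:ℝ) (dist x₂ x₃),
        dist (γ₂₃ s) (γ₂₃ t) ≤ dist (cmpPt y₂ y₃ s) (cmpPt y₂ y₃ t)) ∧
      (∀ s ∈ Set.Icc (0:ℝ) (dist x₁ x₂), ∀ t ∈ Set.Icc (0:ℝ) (dist x₁ x₃),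
        dist (γ₁₂ s) (γ₁₃ t) ≤ dist (cmpPt y₁ y₂ s) (cmpPt y₁ y₃ t)) ∧
      (∀ s ∈ Set.Icc (0:ℝ) (dist x₁ x₂), ∀ t ∈ Set.Icc (0:ℝ) (dist x₂ x₃),
        dist (γ₁₂ s) (γ₂₃ t) ≤ dist (cmpPt y₁ y₂ s) (cmpPt y₂ y₃ t)) ∧
      (∀ s ∈ Set.Icc (0:ℝ) (dist x₁ x₃), ∀ t ∈ Set.Icc (0:ℝ) (dist x₂ x₃),
        dist (γ₁₃ s) (γ₂₃ t) ≤ dist (cmpPt y₁ y₃ s) (cmpPt y₂ y₃ t))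

/-- ρ(x₁,x₂,x₃) for given (Gromov product) radii r₁,r₂,r₃. -/
noncomputable def rho3 {X : Type*} [MetricSpace X] (x₁ x₂ x₃ : X) (r₁ r₂ r₃ : ℝ) : ℝ :=
  ⨅ x : X, max (dist x₁ x / r₁) (max (dist x₂ x / r₂) (dist x₃ x / r₃))

theorem EuclideanSpace.exists_triangle {a b c : ℝ} (ha : 0 < a) (hb : 0 ≤ b) (hc : 0 ≤ c)
    (hab : a ≤ b + c) (hbc : b ≤ a + c) (hca : c ≤ a + b) :
    ∃ y₁ y₂ y₃ : EuclideanSpace ℝ (Fin 2), dist y₁ y₂ = a ∧ dist y₁ y₃ = b ∧ dist y₂ y₃ = c := by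
  set u : ℝ := (a ^ 2 + b ^ 2 - c ^ 2) / (2 * a) with hu
  have hua : 2 * a * u = a ^ 2 + b ^ 2 - c ^ 2 := by rw [hu]; field_simp
  have hub : 0 ≤ b ^ 2 - u ^ 2 := by
    have h : 0 ≤ (2 * a) ^ 2 * (b ^ 2 - u ^ 2) := by
      have e : (2 * a) ^ 2 * (b ^ 2 - u ^ 2) =
          ((a + b + c) * (a + b - c)) * ((c + a - b) * (c + b - a)) := by
        linear_combination (-(2 * a * u) - (a ^ 2 + b ^ 2 - c ^ 2)) * hua
      rw [e]
      exact mul_nonneg (mul_nonneg (by linarith) (by linarith))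
        (mul_nonneg (by linarith) (by linarith))
    exact nonneg_of_mul_nonneg_right h (by positivity)
  have hv := Real.sq_sqrt hub
  refine ⟨!₂[0, 0], !₂[a, 0], !₂[u, √(b ^ 2 - u ^ 2)], ?_, ?_, ?_⟩
  · rw [EuclideanSpace.dist_eq, Real.sqrt_eq_iff_mul_self_eq (by positivity) ha.le]
    simp [Fin.sum_univ_two, Real.dist_eq, sq_abs]
    ring
  · rw [EuclideanSpace.dist_eq, Real.sqrt_eq_iff_mul_self_eq (by positivity) hb]
    simp only [Fin.sum_univ_two, Real.dist_eq, sq_abs, Matrix.cons_val_zero,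
      Matrix.cons_val_one]
    linarith
  · rw [EuclideanSpace.dist_eq, Real.sqrt_eq_iff_mul_self_eq (by positivity) hc]
    simp only [Fin.sum_univ_two, Real.dist_eq, sq_abs, Matrix.cons_val_zero,
      Matrix.cons_val_one]
    linarith

theorem cmpPt_dist (a b : EuclideanSpace ℝ (Fin 2)) : cmpPt a b (dist a b) = b := by
  rcases eq_or_ne a b with rfl | h
  · simp [cmpPt]
  · simp [cmpPt, div_self (dist_ne_zero.2 h)]

theorem dist_lineMap_sq {E : Type*} [NormedAddCommGroup E] [InnerProductSpace ℝ E]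
    (a b c : E) (t : ℝ) :
    dist c (AffineMap.lineMap a b t) ^ 2 =
      (1 - t) * dist c a ^ 2 + t * dist c b ^ 2 - t * (1 - t) * dist a b ^ 2 := by
  have e₁ : c - AffineMap.lineMap a b t = (1 - t) • (c - a) + t • (c - b) := by
    rw [AffineMap.lineMap_apply_module]; module
  have e₂ : a - b = (c - b) - (c - a) := by abel
  rw [dist_eq_norm, dist_eq_norm, dist_eq_norm, dist_eq_norm, e₁, e₂, norm_add_sq_real,
    norm_sub_sq_real (c - b), norm_smul, norm_smul, real_inner_smul_left, real_inner_smul_right,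
    mul_pow, mul_pow, Real.norm_eq_abs, Real.norm_eq_abs, sq_abs, sq_abs,
    real_inner_comm (c - a) (c - b)]
  ring

/-- The Bruhat–Tits (CN) inequality. -/
theorem IsCAT0.exists_dist_sq_le {X : Type*} [MetricSpace X] (hX : IsCAT0 X) (x y : X) {t : ℝ}
    (ht : t ∈ Set.Icc (0 : ℝ) 1) :
    ∃ z : X, ∀ w : X, dist w z ^ 2 ≤
      (1 - t) * dist w x ^ 2 + t * dist w y ^ 2 - t * (1 - t) * dist x y ^ 2 := by
  rcases eq_or_ne x y with rfl | hxy
  · exact ⟨x, fun w => by rw [dist_self]; linarith⟩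
  have hpos : 0 < dist x y := dist_pos.2 hxy
  obtain ⟨γ, hγ⟩ := hX.1 x y
  refine ⟨γ (t * dist x y), fun w => ?_⟩
  obtain ⟨α, hα⟩ := hX.1 x w
  obtain ⟨β, hβ⟩ := hX.1 y w
  obtain ⟨y₁, y₂, y₃, h₁₂, h₁₃, h₂₃⟩ := EuclideanSpace.exists_triangle hpos
    (dist_nonneg (x := x) (y := w)) (dist_nonneg (x := y) (y := w))
    (by rw [dist_comm y w]; exact dist_triangle _ _ _) (dist_triangle _ _ _)
    (by rw [dist_comm x y]; exact dist_triangle _ _ _)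
  have h := (hX.2 x y w γ α β hγ hα hβ y₁ y₂ y₃ h₁₂ h₁₃ h₂₃).2.2.2.1 (t * dist x y)
    ⟨by nlinarith [ht.1], by nlinarith [ht.2]⟩ (dist x w) ⟨dist_nonneg, le_rfl⟩
  rw [hα.2.1, ← h₁₃, cmpPt_dist, cmpPt, h₁₂, mul_div_cancel_right₀ _ hpos.ne', dist_comm,
    dist_comm (AffineMap.lineMap _ _ _)] at h
  calc dist w (γ (t * dist x y)) ^ 2 ≤ dist y₃ (AffineMap.lineMap y₁ y₂ t) ^ 2 := by gcongr
    _ = _ := by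
      rw [dist_lineMap_sq, dist_comm y₃ y₁, dist_comm y₃ y₂, h₁₂, h₁₃, h₂₃, dist_comm w x,
        dist_comm w y]

/-- A convex alternative: finitely many functions that are jointly convex have a common point of
negativity, or some convex combination of them is nonnegative. -/
theorem exists_weights_of_forall_exists_nonneg {ι X : Type*} [Fintype ι] [Nonempty X]
    (f : ι → X → ℝ)
    (hconv : ∀ x y, ∀ t ∈ Set.Icc (0 : ℝ) 1, ∃ z, ∀ i, f i z ≤ (1 - t) * f i x + t * f i y)
    (hf : ∀ x, ∃ i, 0 ≤ f i x) :
    ∃ w : ι → ℝ, (∀ i, 0 ≤ w i) ∧ ∑ i, w i = 1 ∧ ∀ x, 0 ≤ ∑ i, w i * f i x := by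
  classical
  let S : Set (ι → ℝ) := Set.univ.pi fun _ => Set.Iio 0
  let T : Set (ι → ℝ) := {v | ∃ x, ∀ i, f i x ≤ v i}
  have hS : Convex ℝ S := convex_pi fun _ _ => convex_Iio 0
  have hSo : IsOpen S := isOpen_set_pi Set.finite_univ fun _ _ => isOpen_Iio
  have hT : Convex ℝ T := by
    rintro v ⟨x, hx⟩ v' ⟨y, hy⟩ a b ha hb hab
    obtain ⟨z, hz⟩ := hconv x y b ⟨hb, by linarith⟩
    refine ⟨z, fun i => (hz i).trans ?_⟩
    have e : 1 - b = a := by linarith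
    rw [e]
    simp only [Pi.add_apply, Pi.smul_apply, smul_eq_mul]
    gcongr
    exacts [hx i, hy i]
  have hST : Disjoint S T := by
    rw [Set.disjoint_left]
    rintro v hv ⟨x, hx⟩
    obtain ⟨i, hi⟩ := hf x
    have : v i < 0 := hv i (Set.mem_univ i)
    linarith [hx i]
  obtain ⟨φ, u, hφS, hφT⟩ := geometric_hahn_banach_open hS hSo hT hST
  let c : ι → ℝ := fun i => φ (Pi.single i 1)
  have hφ : ∀ v, φ v = ∑ i, c i * v i := fun v => by
    conv_lhs => rw [← Finset.univ_sum_single v, map_sum]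
    refine Finset.sum_congr rfl fun i _ => ?_
    have : (Pi.single i (v i) : ι → ℝ) = v i • Pi.single i 1 := by
      rw [← Pi.single_smul, smul_eq_mul, mul_one]
    rw [this, map_smul, smul_eq_mul, mul_comm]
  have hc : ∀ i, 0 ≤ c i := fun i => by
    by_contra! h
    obtain ⟨x⟩ := ‹Nonempty X›
    let v : ι → ℝ := fun j => f j x
    let s : ℝ := (φ v - u + 1) / -c i
    have hv : u ≤ φ v := hφT v ⟨x, fun _ => le_rfl⟩
    have hs : 0 ≤ s := div_nonneg (by linarith) (by linarith)
    have hm : v + s • Pi.single i 1 ∈ T := ⟨x, fun j => by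
      have : (0 : ι → ℝ) ≤ s • Pi.single i 1 := smul_nonneg hs (by simp)
      simpa [v] using this j⟩
    have h1 := hφT _ hm
    rw [map_add, map_smul, smul_eq_mul] at h1
    have h2 : s * c i = -(φ v - u + 1) := by
      have : c i ≠ 0 := h.ne
      simp only [s]
      field_simp
    change u ≤ φ v + s * c i at h1
    linarith
  have hneg : ∀ ε > 0, -ε * ∑ i, c i < u := fun ε hε => by
    have h := hφS (fun _ => -ε) fun i _ => by simpa using hε
    rw [hφ, ← Finset.sum_mul] at h
    linarith
  have hu : 0 ≤ u := by
    have hc0 : 0 ≤ ∑ i, c i := Finset.sum_nonneg fun i _ => hc i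
    by_contra! h
    have hp : 0 < ∑ i, c i + 1 := by linarith
    have h1 := hneg (-u / (∑ i, c i + 1)) (div_pos (by linarith) hp)
    have h2 : -(-u / (∑ i, c i + 1)) * (∑ i, c i + 1) = u := by field_simp
    nlinarith [div_pos (neg_pos.2 h) hp]
  have hsum : ∀ x, 0 ≤ ∑ i, c i * f i x := fun x => by
    rw [← hφ fun i => f i x]
    exact hu.trans (hφT _ ⟨x, fun _ => le_rfl⟩)
  have hpos : 0 < ∑ i, c i := by
    refine (Finset.sum_nonneg fun i _ => hc i).lt_of_ne' fun h => ?_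
    have hci : ∀ i, c i = 0 := fun i =>
      (Finset.sum_eq_zero_iff_of_nonneg fun i _ => hc i).1 h i (Finset.mem_univ i)
    obtain ⟨x⟩ := ‹Nonempty X›
    have h1 := hneg 1 one_pos
    have h2 := hφT (fun i => f i x) ⟨x, fun _ => le_rfl⟩
    rw [hφ] at h2
    simp only [hci, zero_mul, Finset.sum_const_zero, mul_zero] at h1 h2
    linarith
  refine ⟨fun i => c i / ∑ j, c j, fun i => div_nonneg (hc i) hpos.le, ?_, fun x => ?_⟩
  · rw [← Finset.sum_div, div_self hpos.ne']
  · have e : ∑ i, c i / (∑ j, c j) * f i x = (∑ i, c i * f i x) / ∑ j, c j := by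
      rw [Finset.sum_div]
      exact Finset.sum_congr rfl fun i _ => by ring
    rw [e]
    exact div_nonneg (hsum x) hpos.le

theorem sum_sum_dist_sq_le {E ι : Type*} [NormedAddCommGroup E] [InnerProductSpace ℝ E]
    [Fintype ι] {w : ι → ℝ} (hw : ∑ i, w i = 1) (y : ι → E) (p : E) :
    ∑ j, w j * ∑ i, w i * dist (y i) (y j) ^ 2 ≤ 2 * ∑ i, w i * dist (y i) p ^ 2 := by
  let v : ι → E := fun i => y i - p
  have key : ∀ i j, dist (y i) (y j) ^ 2 = ‖v i‖ ^ 2 - 2 * inner ℝ (v i) (v j) + ‖v j‖ ^ 2 :=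
    fun i j => by
      rw [← norm_sub_sq_real, dist_eq_norm]
      simp [v]
  have hsq : ‖∑ i, w i • v i‖ ^ 2 = ∑ j, w j * ∑ i, w i * inner ℝ (v i) (v j) := by
    rw [← real_inner_self_eq_norm_sq, inner_sum]
    refine Finset.sum_congr rfl fun j _ => ?_
    rw [real_inner_smul_right, sum_inner]
    simp only [real_inner_smul_left]
  have e : ∑ j, w j * ∑ i, w i * dist (y i) (y j) ^ 2 =
      2 * ∑ i, w i * ‖v i‖ ^ 2 - 2 * ‖∑ i, w i • v i‖ ^ 2 := by
    have inner_eq : ∀ j, w j * ∑ i, w i * dist (y i) (y j) ^ 2 =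
        w j * (∑ i, w i * ‖v i‖ ^ 2) - 2 * (w j * ∑ i, w i * inner ℝ (v i) (v j)) +
          w j * ‖v j‖ ^ 2 := fun j => by
      have : ∑ i, w i * dist (y i) (y j) ^ 2 = ∑ i, w i * ‖v i‖ ^ 2 -
          2 * (∑ i, w i * inner ℝ (v i) (v j)) + (∑ i, w i) * ‖v j‖ ^ 2 := by
        rw [Finset.mul_sum, Finset.sum_mul, ← Finset.sum_sub_distrib, ← Finset.sum_add_distrib]
        exact Finset.sum_congr rfl fun i _ => by rw [key]; ring
      rw [this, hw]
      ring
    rw [Finset.sum_congr rfl fun j _ => inner_eq j, Finset.sum_add_distrib,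
      Finset.sum_sub_distrib, ← Finset.sum_mul, ← Finset.mul_sum, hw, ← hsq]
    ring
  rw [e]
  simp only [dist_eq_norm]
  change _ ≤ 2 * ∑ i, w i * ‖v i‖ ^ 2
  linarith [sq_nonneg ‖∑ i, w i • v i‖]

theorem IsCAT0.two_mul_iInf_le {X ι : Type*} [MetricSpace X] (hX : IsCAT0 X) [Fintype ι]
    {w : ι → ℝ} (hw₀ : ∀ i, 0 ≤ w i) (hw : ∑ i, w i = 1) (x : ι → X) :
    2 * ⨅ z, ∑ i, w i * dist (x i) z ^ 2 ≤ ∑ j, w j * ∑ i, w i * dist (x i) (x j) ^ 2 := by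
  set G : X → ℝ := fun z => ∑ i, w i * dist (x i) z ^ 2 with hG
  set A : ℝ := ∑ j, w j * G (x j)
  have hne : Nonempty X := by
    by_contra h
    have : IsEmpty ι := ⟨fun i => h ⟨x i⟩⟩
    simp at hw
  have hG0 : ∀ z, 0 ≤ G z := fun z => Finset.sum_nonneg fun i _ => mul_nonneg (hw₀ i) (sq_nonneg _)
  have hbdd : BddBelow (Set.range G) := ⟨0, by rintro _ ⟨z, rfl⟩; exact hG0 z⟩
  have step : ∀ t ∈ Set.Ioo (0 : ℝ) 1, ∀ z, (⨅ z, G z) ≤ (1 - t) ^ 2 * G z + t * A := by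
    intro t ht z
    have hj : ∀ j, (⨅ z, G z) ≤
        (1 - t) * G z + t * G (x j) - t * (1 - t) * dist (x j) z ^ 2 := fun j => by
      obtain ⟨q, hq⟩ := hX.exists_dist_sq_le z (x j) ⟨ht.1.le, ht.2.le⟩
      refine (ciInf_le hbdd q).trans ?_
      calc G q ≤ ∑ i, w i * ((1 - t) * dist (x i) z ^ 2 + t * dist (x i) (x j) ^ 2 -
            t * (1 - t) * dist (x j) z ^ 2) := by
            refine Finset.sum_le_sum fun i _ => mul_le_mul_of_nonneg_left ?_ (hw₀ i)
            rw [dist_comm (x j) z]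
            exact hq (x i)
        _ = (1 - t) * G z + t * G (x j) - t * (1 - t) * dist (x j) z ^ 2 * ∑ i, w i := by
            simp only [hG, Finset.mul_sum]
            rw [← Finset.sum_add_distrib, ← Finset.sum_sub_distrib]
            exact Finset.sum_congr rfl fun i _ => by ring
        _ = _ := by rw [hw, mul_one]
    calc (⨅ z, G z) = ∑ j, w j * ⨅ z, G z := by rw [← Finset.sum_mul, hw, one_mul]
      _ ≤ ∑ j, w j * ((1 - t) * G z + t * G (x j) - t * (1 - t) * dist (x j) z ^ 2) :=
          Finset.sum_le_sum fun j _ => mul_le_mul_of_nonneg_left (hj j) (hw₀ j)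
      _ = (∑ j, w j) * ((1 - t) * G z) + t * A - t * (1 - t) * G z := by
          rw [show t * (1 - t) * G z = ∑ j, t * (1 - t) * (w j * dist (x j) z ^ 2) from
            Finset.mul_sum _ _ _, show t * A = ∑ j, t * (w j * G (x j)) from
            Finset.mul_sum _ _ _, Finset.sum_mul, ← Finset.sum_add_distrib,
            ← Finset.sum_sub_distrib]
          exact Finset.sum_congr rfl fun j _ => by ring
      _ = _ := by rw [hw]; ring
  have hI : ∀ t ∈ Set.Ioo (0 : ℝ) 1, (2 - t) * (⨅ z, G z) ≤ A := by
    intro t ht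
    have h1t : 0 < (1 - t) ^ 2 := pow_pos (by linarith [ht.2]) 2
    have h : ((⨅ z, G z) - t * A) / (1 - t) ^ 2 ≤ ⨅ z, G z := le_ciInf fun z => by
      rw [div_le_iff₀ h1t]
      linarith [step t ht z]
    rw [div_le_iff₀ h1t] at h
    have h' : t * ((2 - t) * (⨅ z, G z)) ≤ t * A := by linarith
    exact le_of_mul_le_mul_left h' ht.1
  have hI0 : 0 ≤ ⨅ z, G z := le_ciInf hG0
  refine le_of_forall_pos_le_add fun ε hε => ?_
  have hp : 0 < (⨅ z, G z) + 2 * ε + 1 := by linarith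
  have ht : ε / ((⨅ z, G z) + 2 * ε + 1) * ((⨅ z, G z) + 2 * ε + 1) = ε := by field_simp
  have htpos := div_pos hε hp
  have h := hI (ε / ((⨅ z, G z) + 2 * ε + 1))
    ⟨htpos, by rw [div_lt_one hp]; linarith⟩
  change 2 * (⨅ z, G z) ≤ A + ε
  nlinarith

/-- An approximate one-point Kirszbraun extension from an inner product space to a CAT(0) space. -/
theorem IsCAT0.exists_forall_dist_lt {X E ι : Type*} [MetricSpace X] (hX : IsCAT0 X)
    [NormedAddCommGroup E] [InnerProductSpace ℝ E] [Fintype ι] [Nonempty ι]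
    (x : ι → X) (y : ι → E) (hxy : ∀ i j, dist (x i) (x j) ≤ dist (y i) (y j)) (p : E)
    {ε : ℝ} (hε : 0 < ε) : ∃ z, ∀ i, dist (x i) z < dist (y i) p + ε := by
  by_contra! hcon
  have : Nonempty X := ‹Nonempty ι›.map x
  obtain ⟨w, hw₀, hw, h⟩ := exists_weights_of_forall_exists_nonneg
    (fun i z => dist (x i) z ^ 2 - (dist (y i) p ^ 2 + ε ^ 2))
    (fun a b t ht => by
      obtain ⟨z, hz⟩ := hX.exists_dist_sq_le a b ht
      refine ⟨z, fun i => ?_⟩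
      have : 0 ≤ t * (1 - t) * dist a b ^ 2 :=
        mul_nonneg (mul_nonneg ht.1 (by linarith [ht.2])) (sq_nonneg _)
      linarith [hz (x i)])
    (fun z => by
      obtain ⟨i, hi⟩ := hcon z
      exact ⟨i, by nlinarith [dist_nonneg (x := y i) (y := p), dist_nonneg (x := x i) (y := z)]⟩)
  have hlow : (∑ i, w i * dist (y i) p ^ 2) + ε ^ 2 ≤ ⨅ z, ∑ i, w i * dist (x i) z ^ 2 :=
    le_ciInf fun z => by
      have e : ∑ i, w i * (dist (x i) z ^ 2 - (dist (y i) p ^ 2 + ε ^ 2)) =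
          ∑ i, w i * dist (x i) z ^ 2 - (∑ i, w i * dist (y i) p ^ 2 + (∑ i, w i) * ε ^ 2) := by
        rw [Finset.sum_mul, ← Finset.sum_add_distrib, ← Finset.sum_sub_distrib]
        exact Finset.sum_congr rfl fun i _ => by ring
      have hz := h z
      rw [e, hw] at hz
      linarith
  have hle : ∑ j, w j * ∑ i, w i * dist (x i) (x j) ^ 2 ≤
      ∑ j, w j * ∑ i, w i * dist (y i) (y j) ^ 2 := by
    gcongr with j _ i _
    exacts [hw₀ j, hw₀ i, hxy i j]
  have := hX.two_mul_iInf_le hw₀ hw x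
  have := sum_sum_dist_sq_le hw y p
  have : 0 < ε ^ 2 := by positivity
  linarith

/-- Every complete CAT(0) space has non-positive curvature in the sense of
intersection of balls. -/
theorem stmt5 {X : Type*} [MetricSpace X] [CompleteSpace X] (hX : IsCAT0 X)
    (x₁ x₂ x₃ : X) (r₁ r₂ r₃ : ℝ)
    (hr₁ : r₁ = (dist x₁ x₂ + dist x₁ x₃ - dist x₂ x₃) / 2)
    (hr₂ : r₂ = (dist x₁ x₂ + dist x₂ x₃ - dist x₁ x₃) / 2)
    (hr₃ : r₃ = (dist x₁ x₃ + dist x₂ x₃ - dist x₁ x₂) / 2)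
    (h₁ : 0 < r₁) (h₂ : 0 < r₂) (h₃ : 0 < r₃)
    (y₁ y₂ y₃ : EuclideanSpace ℝ (Fin 2))
    (hy₁₂ : dist y₁ y₂ = dist x₁ x₂)
    (hy₁₃ : dist y₁ y₃ = dist x₁ x₃)
    (hy₂₃ : dist y₂ y₃ = dist x₂ x₃) :
    rho3 x₁ x₂ x₃ r₁ r₂ r₃ ≤ rho3 y₁ y₂ y₃ r₁ r₂ r₃ := by
  unfold rho3
  refine le_ciInf fun p => le_of_forall_pos_le_add fun ε hε => ?_
  set C : ℝ := 1 / r₁ + 1 / r₂ + 1 / r₃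
  have i₁ : 0 < 1 / r₁ := by positivity
  have i₂ : 0 < 1 / r₂ := by positivity
  have i₃ : 0 < 1 / r₃ := by positivity
  have hC0 : 0 < C := by positivity
  have hη : 0 < ε / C := div_pos hε hC0
  have hdist : ∀ i j, dist (![x₁, x₂, x₃] i) (![x₁, x₂, x₃] j) ≤
      dist (![y₁, y₂, y₃] i) (![y₁, y₂, y₃] j) := by
    intro i j
    fin_cases i <;> fin_cases j <;>
      simp [hy₁₂, hy₁₃, hy₂₃, dist_comm x₂ x₁, dist_comm x₃ x₁, dist_comm x₃ x₂,
        dist_comm y₂ y₁, dist_comm y₃ y₁, dist_comm y₃ y₂]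
  obtain ⟨z, hz⟩ := hX.exists_forall_dist_lt ![x₁, x₂, x₃] ![y₁, y₂, y₃] hdist p hη
  have hbound : ∀ {d D r : ℝ}, 0 < r → 1 / r ≤ C → d < D + ε / C → d / r ≤ D / r + ε := by
    intro d D r hr hrC hd
    calc d / r ≤ (D + ε / C) / r := by gcongr
      _ = D / r + 1 / r * (ε / C) := by ring
      _ ≤ D / r + C * (ε / C) := by gcongr
      _ = D / r + ε := by rw [mul_div_cancel₀ _ hC0.ne']
  have hbdd : BddBelow (Set.range fun x : X =>
      max (dist x₁ x / r₁) (max (dist x₂ x / r₂) (dist x₃ x / r₃))) :=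
    ⟨0, by rintro _ ⟨x, rfl⟩; exact le_max_of_le_left (by positivity)⟩
  refine (ciInf_le hbdd z).trans ?_
  rw [← max_add_add_right, ← max_add_add_right]
  exact max_le_max (hbound h₁ (by linarith) (hz 0))
    (max_le_max (hbound h₂ (by linarith) (hz 1)) (hbound h₃ (by linarith) (hz 2)))
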